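/- arXiv:1408.6818 — 2 statements merged into one kernel-verified Lean document; each statement's English description precedes it below -/
import Mathlib

section
/- Let d ≥ 1 and let G be an invertible complex symmetric d×d matrix (Gᵀ = G). If the real symmetric matrix Re(G⁻¹) (the entrywise real parts of G⁻¹) is positive definite, then Re G is positive definite. -/
open Matrix

theorem re_mul_aux {d : ℕ} (M N : Matrix (Fin d) (Fin d) ℂ) :
    (M * N).map Complex.re
      = M.map Complex.re * N.map Complex.re - M.map Complex.im * N.map Complex.im := by
  ext i j
  simp [Matrix.mul_apply, Complex.mul_re, Finset.sum_sub_distrib]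

theorem im_mul_aux {d : ℕ} (M N : Matrix (Fin d) (Fin d) ℂ) :
    (M * N).map Complex.im
      = M.map Complex.re * N.map Complex.im + M.map Complex.im * N.map Complex.re := by
  ext i j
  simp [Matrix.mul_apply, Complex.mul_im, Finset.sum_add_distrib]

/-- London's property used at the start of the proof of Lemma 3.3(a).
If `G` is an invertible complex symmetric matrix and the real symmetric matrix
`Re(G⁻¹)` (entrywise real parts) is positive definite, then `Re G` is positive definite. -/
theorem statement7 {d : ℕ} (hd : 1 ≤ d)
    (G : Matrix (Fin d) (Fin d) ℂ) (hinv : IsUnit G.det) (hsym : Gᵀ = G)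
    (hReInv : ((G⁻¹).map Complex.re).PosDef) :
    (G.map Complex.re).PosDef := by
  have h1 := re_mul_aux G G⁻¹
  have h2 := re_mul_aux G⁻¹ G
  have h3 := im_mul_aux G⁻¹ G
  rw [Matrix.mul_nonsing_inv _ hinv] at h1
  rw [Matrix.nonsing_inv_mul _ hinv] at h2 h3
  have e1 : (1 : Matrix (Fin d) (Fin d) ℂ).map Complex.re = 1 := by
    ext i j; by_cases h : i = j <;> simp [Matrix.one_apply, h]
  have e2 : (1 : Matrix (Fin d) (Fin d) ℂ).map Complex.im = 0 := by
    ext i j; by_cases h : i = j <;> simp [Matrix.one_apply, h]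
  have hX : (G.map Complex.re)ᵀ = G.map Complex.re := by
    rw [← Matrix.transpose_map, hsym]
  have hY : (G.map Complex.im)ᵀ = G.map Complex.im := by
    rw [← Matrix.transpose_map, hsym]
  rw [e1] at h1 h2
  rw [e2] at h3
  generalize G.map Complex.re = X at *
  generalize G.map Complex.im = Y at *
  generalize G⁻¹.map Complex.re = A at *
  generalize G⁻¹.map Complex.im = B at *
  have key : X = X * A * X + Y * A * Y := by
    have t : Y * A * Y = - (Y * B * X) := by
      rw [Matrix.mul_assoc, eq_neg_of_add_eq_zero_left h3.symm, Matrix.mul_neg, Matrix.mul_assoc]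
    calc X = 1 * X := (Matrix.one_mul X).symm
      _ = (X * A - Y * B) * X := by rw [← h1]
      _ = _ := by rw [t, Matrix.sub_mul, sub_eq_add_neg]
  have hq : ∀ Z : Matrix (Fin d) (Fin d) ℝ, Zᵀ = Z → ∀ x,
      star x ⬝ᵥ ((Z * A * Z) *ᵥ x) = star (Z *ᵥ x) ⬝ᵥ (A *ᵥ (Z *ᵥ x)) := by
    intro Z hZ x
    rw [Matrix.mul_assoc, ← Matrix.mulVec_mulVec, ← Matrix.mulVec_mulVec,
      Matrix.dotProduct_mulVec, star_trivial, star_trivial, ← Matrix.mulVec_transpose, hZ]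
  refine Matrix.PosDef.of_dotProduct_mulVec_pos ?_ fun x hx => ?_
  · rw [Matrix.IsHermitian, Matrix.conjTranspose_eq_transpose_of_trivial, hX]
  · rw [key, Matrix.add_mulVec, dotProduct_add, hq X hX, hq Y hY]
    have nx := hReInv.posSemidef.dotProduct_mulVec_nonneg (X *ᵥ x)
    have ny := hReInv.posSemidef.dotProduct_mulVec_nonneg (Y *ᵥ x)
    by_cases hx0 : X *ᵥ x = 0
    · have hy0 : Y *ᵥ x ≠ 0 := by
        intro hy0
        apply hx
        rw [← Matrix.one_mulVec x, h2, Matrix.sub_mulVec, ← Matrix.mulVec_mulVec,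
          ← Matrix.mulVec_mulVec, hx0, hy0]
        simp
      have := hReInv.dotProduct_mulVec_pos hy0
      linarith
    · have := hReInv.dotProduct_mulVec_pos hx0
      linarith
end

section
/- Let d ≥ 1, let U ⊂ ℝ^d be open, and let F : U → ℝ^d be injective and continuously differentiable on U with constants 0 < F_min ≤ F_max < ∞ such that F_min·‖w‖ ≤ ‖DF(x)w‖ ≤ F_max·‖w‖ for every x ∈ U and w ∈ ℝ^d. Then for every continuously differentiable v : F(U) → ℝ, the gradient satisfies ∇(v∘F)(x) = DF(x)ᵀ (∇v)(F(x)) for all x ∈ U, and consequently F_min² · F_max^{−d} · ∫_{F(U)} ‖∇v(y)‖² dy ≤ ∫_U ‖∇(v∘F)(x)‖² dx ≤ F_max² · F_min^{−d} · ∫_{F(U)} ‖∇v(y)‖² dy. -/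
open MeasureTheory Metric

lemma aux_surj {d : ℕ} (A : EuclideanSpace ℝ (Fin d) →L[ℝ] EuclideanSpace ℝ (Fin d)) {m : ℝ}
    (hm : 0 < m) (h : ∀ w, m * ‖w‖ ≤ ‖A w‖) : Function.Surjective A := by
  have hi : Function.Injective (A : EuclideanSpace ℝ (Fin d) →ₗ[ℝ] EuclideanSpace ℝ (Fin d)) := by
    rw [injective_iff_map_eq_zero]
    intro w hw
    have h1 := h w
    have h2 : A w = 0 := hw
    rw [h2, norm_zero] at h1
    have h3 : ‖w‖ ≤ 0 := by
      by_contra hc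
      push Not at hc
      have := mul_pos hm hc
      linarith
    exact norm_le_zero_iff.mp h3
  exact LinearMap.injective_iff_surjective.mp hi

lemma aux_det_le {d : ℕ} (A : EuclideanSpace ℝ (Fin d) →L[ℝ] EuclideanSpace ℝ (Fin d)) {M : ℝ}
    (hM : 0 ≤ M) (h : ∀ w, ‖A w‖ ≤ M * ‖w‖) : |A.det| ≤ M ^ d := by
  have h1 : A '' closedBall 0 1 ⊆ closedBall 0 M := by
    rintro _ ⟨w, hw, rfl⟩
    rw [mem_closedBall_zero_iff] at hw ⊢
    exact (h w).trans (by nlinarith)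
  have h2 := measure_mono (μ := volume) h1
  rw [Measure.addHaar_image_continuousLinearMap, Measure.addHaar_closedBall _ _ hM,
    Measure.addHaar_closedBall _ _ zero_le_one, finrank_euclideanSpace_fin] at h2
  simp only [one_pow, ENNReal.ofReal_one, one_mul] at h2
  have h3 := (ENNReal.mul_le_mul_iff_left (measure_ball_pos _ _ one_pos).ne'
    measure_ball_lt_top.ne).mp h2
  exact (ENNReal.ofReal_le_ofReal_iff (by positivity)).mp h3

lemma aux_le_det {d : ℕ} (A : EuclideanSpace ℝ (Fin d) →L[ℝ] EuclideanSpace ℝ (Fin d)) {m : ℝ}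
    (hm : 0 < m) (h : ∀ w, m * ‖w‖ ≤ ‖A w‖) : m ^ d ≤ |A.det| := by
  have h1 : closedBall 0 m ⊆ A '' closedBall 0 1 := by
    intro y hy
    obtain ⟨w, rfl⟩ := aux_surj A hm h y
    refine ⟨w, ?_, rfl⟩
    rw [mem_closedBall_zero_iff] at hy ⊢
    have := (h w).trans hy
    by_contra hc
    push Not at hc
    nlinarith
  have h2 := measure_mono (μ := volume) h1
  rw [Measure.addHaar_image_continuousLinearMap, Measure.addHaar_closedBall _ _ hm.le,
    Measure.addHaar_closedBall _ _ zero_le_one, finrank_euclideanSpace_fin] at h2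
  simp only [one_pow, ENNReal.ofReal_one, one_mul] at h2
  have h3 := (ENNReal.mul_le_mul_iff_left (measure_ball_pos _ _ one_pos).ne'
    measure_ball_lt_top.ne).mp h2
  exact (ENNReal.ofReal_le_ofReal_iff (by positivity)).mp h3

lemma aux_adj_le {d : ℕ} (A : EuclideanSpace ℝ (Fin d) →L[ℝ] EuclideanSpace ℝ (Fin d)) {M : ℝ}
    (hM : 0 ≤ M) (h : ∀ w, ‖A w‖ ≤ M * ‖w‖) (w : EuclideanSpace ℝ (Fin d)) :
    ‖ContinuousLinearMap.adjoint A w‖ ≤ M * ‖w‖ := by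
  refine (ContinuousLinearMap.le_opNorm _ w).trans ?_
  rw [LinearIsometryEquiv.norm_map]
  gcongr
  exact A.opNorm_le_bound hM h

lemma aux_le_adj {d : ℕ} (A : EuclideanSpace ℝ (Fin d) →L[ℝ] EuclideanSpace ℝ (Fin d)) {m : ℝ}
    (hm : 0 < m) (h : ∀ w, m * ‖w‖ ≤ ‖A w‖) (w : EuclideanSpace ℝ (Fin d)) :
    m * ‖w‖ ≤ ‖ContinuousLinearMap.adjoint A w‖ := by
  obtain ⟨u, rfl⟩ := aux_surj A hm h w
  have h1 : ‖A u‖ * ‖A u‖ ≤ ‖u‖ * ‖ContinuousLinearMap.adjoint A (A u)‖ := by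
    rw [← real_inner_self_eq_norm_mul_norm, ← ContinuousLinearMap.adjoint_inner_right]
    exact real_inner_le_norm _ _
  have h2 := h u
  rcases (norm_nonneg (A u)).eq_or_lt with h0 | h0
  · rw [← h0]; simp
  · refine le_of_mul_le_mul_left ?_ h0
    have h3 := norm_nonneg (ContinuousLinearMap.adjoint A (A u))
    nlinarith [mul_le_mul_of_nonneg_right h2 h3, mul_le_mul_of_nonneg_left h1 hm.le]

/-- Lemma 2.1(ii) of the paper. If `F` is injective and continuously
differentiable on the open set `U` with `F_min‖w‖ ≤ ‖DF(x)w‖ ≤ F_max‖w‖`, then for every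
continuously differentiable `v : F(U) → ℝ` the chain rule
`∇(v∘F)(x) = DF(x)ᵀ (∇v)(F(x))` holds on `U`, and consequently
`F_min²·F_max^{−d} ∫_{F(U)} ‖∇v‖² ≤ ∫_U ‖∇(v∘F)‖² ≤ F_max²·F_min^{−d} ∫_{F(U)} ‖∇v‖²`. -/
theorem statement16 {d : ℕ} (hd : 1 ≤ d)
    (U : Set (EuclideanSpace ℝ (Fin d))) (hU : IsOpen U)
    (F : EuclideanSpace ℝ (Fin d) → EuclideanSpace ℝ (Fin d)) (hinj : Set.InjOn F U)
    (F' : EuclideanSpace ℝ (Fin d) → EuclideanSpace ℝ (Fin d) →L[ℝ] EuclideanSpace ℝ (Fin d))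
    (hF : ∀ x ∈ U, HasFDerivAt F (F' x) x) (hF'cont : ContinuousOn F' U)
    (Fmin Fmax : ℝ) (hFmin : 0 < Fmin) (hle : Fmin ≤ Fmax)
    (hbound : ∀ x ∈ U, ∀ w : EuclideanSpace ℝ (Fin d),
      Fmin * ‖w‖ ≤ ‖F' x w‖ ∧ ‖F' x w‖ ≤ Fmax * ‖w‖)
    (v : EuclideanSpace ℝ (Fin d) → ℝ)
    (v' : EuclideanSpace ℝ (Fin d) → EuclideanSpace ℝ (Fin d) →L[ℝ] ℝ)
    (hv : ∀ y ∈ F '' U, HasFDerivAt v (v' y) y) (hv'cont : ContinuousOn v' (F '' U)) :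
    (∀ x ∈ U, gradient (v ∘ F) x = ContinuousLinearMap.adjoint (F' x) (gradient v (F x))) ∧
    ENNReal.ofReal (Fmin ^ 2 / Fmax ^ d) *
        (∫⁻ y in F '' U, ENNReal.ofReal (‖gradient v y‖ ^ 2))
      ≤ (∫⁻ x in U, ENNReal.ofReal (‖gradient (v ∘ F) x‖ ^ 2)) ∧
    (∫⁻ x in U, ENNReal.ofReal (‖gradient (v ∘ F) x‖ ^ 2))
      ≤ ENNReal.ofReal (Fmax ^ 2 / Fmin ^ d) *
        (∫⁻ y in F '' U, ENNReal.ofReal (‖gradient v y‖ ^ 2)) := by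
  have hFmax : 0 < Fmax := hFmin.trans_le hle
  have hchain : ∀ x ∈ U, gradient (v ∘ F) x
      = ContinuousLinearMap.adjoint (F' x) (gradient v (F x)) := by
    intro x hx
    have hv1 := hv (F x) ⟨x, hx, rfl⟩
    have hc := hv1.comp x (hF x hx)
    refine ext_inner_right ℝ fun w => ?_
    rw [ContinuousLinearMap.adjoint_inner_left]
    simp only [gradient, InnerProductSpace.toDual_symm_apply, hc.fderiv, hv1.fderiv]
    rfl
  have himg := lintegral_image_eq_lintegral_abs_det_fderiv_mul volume hU.measurableSet
    (fun x hx => (hF x hx).hasFDerivWithinAt) hinj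
    (fun y => ENNReal.ofReal (‖gradient v y‖ ^ 2))
  refine ⟨hchain, ?_, ?_⟩
  · rw [himg, ← lintegral_const_mul' _ _ ENNReal.ofReal_ne_top]
    refine setLIntegral_mono' hU.measurableSet fun x hx => ?_
    rw [hchain x hx, ← ENNReal.ofReal_mul (by positivity), ← ENNReal.ofReal_mul (by positivity)]
    refine ENNReal.ofReal_le_ofReal ?_
    have h1 := aux_det_le (F' x) hFmax.le fun w => (hbound x hx w).2
    have h2 := aux_le_adj (F' x) hFmin (fun w => (hbound x hx w).1) (gradient v (F x))
    calc Fmin ^ 2 / Fmax ^ d * (|(F' x).det| * ‖gradient v (F x)‖ ^ 2)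
        ≤ Fmin ^ 2 / Fmax ^ d * (Fmax ^ d * ‖gradient v (F x)‖ ^ 2) := by gcongr
      _ = (Fmin * ‖gradient v (F x)‖) ^ 2 := by field_simp
      _ ≤ _ := by gcongr
  · rw [himg, ← lintegral_const_mul' _ _ ENNReal.ofReal_ne_top]
    refine setLIntegral_mono' hU.measurableSet fun x hx => ?_
    rw [hchain x hx, ← ENNReal.ofReal_mul (by positivity), ← ENNReal.ofReal_mul (by positivity)]
    refine ENNReal.ofReal_le_ofReal ?_
    have h1 := aux_le_det (F' x) hFmin fun w => (hbound x hx w).1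
    have h2 := aux_adj_le (F' x) hFmax.le (fun w => (hbound x hx w).2) (gradient v (F x))
    calc _ ≤ (Fmax * ‖gradient v (F x)‖) ^ 2 := by gcongr
      _ = Fmax ^ 2 / Fmin ^ d * (Fmin ^ d * ‖gradient v (F x)‖ ^ 2) := by field_simp
      _ ≤ _ := by gcongr
end
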